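/- Let Ω ⊆ ℝ³ be open and t ∈ ℝ. Suppose q₁, q₂, q₃ : Ω → ℝ are smooth, Q = q₁E₁ + q₂E₂ + q₃E₃ solves the one-constant Landau–de Gennes Euler–Lagrange equations on Ω, and Q(x) is uniaxial at every x ∈ Ω (i.e. (tr Q(x)²)³ = 6 (tr Q(x)³)² for all x). Then on every connected component U of {x ∈ Ω : Q(x) ≠ 0} the eigenframe of Q is constant: there exists a fixed orthonormal basis (v₁, v₂, v₃) of ℝ³ such that each vᵢ is an eigenvector of Q(x) for every x ∈ U. Moreover, if Ω is connected, there is a single fixed orthonormal basis of ℝ³ whose elements are eigenvectors of Q(x) for every x ∈ Ω. -/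

import Mathlib

open Real Set Matrix

noncomputable section

/-- Partial derivative in direction `i`. -/
def pd (i : Fin 3) (f : (Fin 3 → ℝ) → ℝ) (x : Fin 3 → ℝ) : ℝ :=
  fderiv ℝ f x (Pi.single i 1)

/-- Laplacian on ℝ³. -/
def lap (f : (Fin 3 → ℝ) → ℝ) (x : Fin 3 → ℝ) : ℝ :=
  ∑ i : Fin 3, pd i (fun y => pd i f y) x

/-- Kronecker delta. -/
def kron (i j : Fin 3) : ℝ := if i = j then 1 else 0

/-- `E₁ = √(3/2) (e_z ⊗ e_z − I/3)`. -/
def E1 : Matrix (Fin 3) (Fin 3) ℝ :=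
  Real.sqrt (3/2) • !![-(1/3 : ℝ), 0, 0; 0, -(1/3), 0; 0, 0, 2/3]

/-- `E₂ = √(1/2) (e_x ⊗ e_x − e_y ⊗ e_y)`. -/
def E2 : Matrix (Fin 3) (Fin 3) ℝ :=
  Real.sqrt (1/2) • !![(1 : ℝ), 0, 0; 0, -1, 0; 0, 0, 0]

/-- `E₃ = √(1/2) (e_x ⊗ e_y + e_y ⊗ e_x)`. -/
def E3 : Matrix (Fin 3) (Fin 3) ℝ :=
  Real.sqrt (1/2) • !![(0 : ℝ), 1, 0; 1, 0, 0; 0, 0, 0]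

/-- The tensor field `Q = q₁E₁ + q₂E₂ + q₃E₃` (with `e_z` a fixed eigenvector). -/
def Qz (q₁ q₂ q₃ : (Fin 3 → ℝ) → ℝ) (x : Fin 3 → ℝ) : Matrix (Fin 3) (Fin 3) ℝ :=
  q₁ x • E1 + q₂ x • E2 + q₃ x • E3

/-- `tr(Q²)` for a matrix-valued field. -/
def trQ2 (Q : (Fin 3 → ℝ) → Matrix (Fin 3) (Fin 3) ℝ) (x : Fin 3 → ℝ) : ℝ :=
  ∑ k : Fin 3, ∑ l : Fin 3, Q x k l * Q x l k

/-- The one-constant Landau–de Gennes Euler–Lagrange equations on Ω. -/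
def LdG_EL (t : ℝ) (Ω : Set (Fin 3 → ℝ)) (Q : (Fin 3 → ℝ) → Matrix (Fin 3) (Fin 3) ℝ) :
    Prop :=
  ∀ x ∈ Ω, ∀ i j : Fin 3,
    lap (fun y => Q y i j) x =
      t * Q x i j
        - 3 * Real.sqrt 6 * ((∑ k : Fin 3, Q x i k * Q x k j) - (1/3) * kron i j * trQ2 Q x)
        + 2 * Q x i j * trQ2 Q x

open MeasureTheory

/-- `f` is differentiable at `x` with `i`-th partial derivative `f'`. -/
def HasPd (i : Fin 3) (f : (Fin 3 → ℝ) → ℝ) (f' : ℝ) (x : Fin 3 → ℝ) : Prop :=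
  DifferentiableAt ℝ f x ∧ pd i f x = f'

namespace HasPd

variable {i : Fin 3} {f g : (Fin 3 → ℝ) → ℝ} {f' g' c : ℝ} {x : Fin 3 → ℝ}

theorem of_differentiableAt (i : Fin 3) (hf : DifferentiableAt ℝ f x) :
    HasPd i f (pd i f x) x := ⟨hf, rfl⟩

theorem of_eq (hf : HasPd i f f' x) (h : f' = g') : HasPd i f g' x := h ▸ hf

theorem const (i : Fin 3) (c : ℝ) (x : Fin 3 → ℝ) : HasPd i (fun _ => c) 0 x :=
  ⟨by fun_prop, by simp [pd]⟩

theorem coord (i j : Fin 3) (x : Fin 3 → ℝ) : HasPd i (fun y => y j) (kron i j) x := by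
  refine ⟨by fun_prop, ?_⟩
  have h : HasFDerivAt (fun y : Fin 3 → ℝ => y j)
      (ContinuousLinearMap.proj (R := ℝ) (φ := fun _ : Fin 3 => ℝ) j) x := hasFDerivAt_apply j x
  rw [pd, h.fderiv]
  simp [kron, Pi.single_apply, eq_comm]

theorem add (hf : HasPd i f f' x) (hg : HasPd i g g' x) :
    HasPd i (fun y => f y + g y) (f' + g') x := by
  refine ⟨hf.1.add hg.1, ?_⟩
  rw [← hf.2, ← hg.2, pd, fderiv_fun_add hf.1 hg.1]
  rfl

theorem sub (hf : HasPd i f f' x) (hg : HasPd i g g' x) :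
    HasPd i (fun y => f y - g y) (f' - g') x := by
  refine ⟨hf.1.sub hg.1, ?_⟩
  rw [← hf.2, ← hg.2, pd, fderiv_fun_sub hf.1 hg.1]
  rfl

theorem mul (hf : HasPd i f f' x) (hg : HasPd i g g' x) :
    HasPd i (fun y => f y * g y) (f x * g' + g x * f') x := by
  refine ⟨hf.1.mul hg.1, ?_⟩
  rw [← hf.2, ← hg.2, pd, fderiv_fun_mul hf.1 hg.1]
  rfl

theorem const_mul (c : ℝ) (hf : HasPd i f f' x) : HasPd i (fun y => c * f y) (c * f') x :=
  ((const i c x).mul hf).of_eq (by ring)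

theorem exp (hf : HasPd i f f' x) :
    HasPd i (fun y => Real.exp (f y)) (Real.exp (f x) * f') x := by
  refine ⟨hf.1.exp, ?_⟩
  rw [← hf.2, pd, fderiv_exp hf.1]
  rfl

theorem sum {F : Fin 3 → (Fin 3 → ℝ) → ℝ} {F' : Fin 3 → ℝ} (h : ∀ j, HasPd i (F j) (F' j) x) :
    HasPd i (fun y => ∑ j, F j y) (∑ j, F' j) x := by
  simp only [Fin.sum_univ_three]
  exact ((h 0).add (h 1)).add (h 2)

theorem congr_of_eventuallyEq (hf : HasPd i f f' x) (h : f =ᶠ[nhds x] g) : HasPd i g f' x := by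
  refine ⟨hf.1.congr_of_eventuallyEq h.symm, ?_⟩
  rw [← hf.2, pd, pd, h.fderiv_eq]

end HasPd

/-- The square of the Euclidean distance from `x` to `a`. -/
def sqDist (a x : Fin 3 → ℝ) : ℝ := ∑ j, (x j - a j) * (x j - a j)

theorem contDiff_sqDist (a : Fin 3 → ℝ) {n : WithTop ℕ∞} : ContDiff ℝ n (sqDist a) := by
  unfold sqDist
  fun_prop

theorem hasPd_sqDist (i : Fin 3) (a x : Fin 3 → ℝ) :
    HasPd i (sqDist a) (2 * (x i - a i)) x := by
  have h : ∀ j, HasPd i (fun y => (y j - a j) * (y j - a j)) (2 * (x j - a j) * kron i j) x :=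
    fun j => (((HasPd.coord i j x).sub (.const i (a j) x)).mul
      ((HasPd.coord i j x).sub (.const i (a j) x))).of_eq (by ring)
  refine (HasPd.sum h).of_eq ?_
  simp [kron]

theorem ContDiffOn.pd {f : (Fin 3 → ℝ) → ℝ} {s : Set (Fin 3 → ℝ)}
    (hf : ContDiffOn ℝ (⊤ : ℕ∞) f s) (hs : IsOpen s) (i : Fin 3) :
    ContDiffOn ℝ (⊤ : ℕ∞) (pd i f) s :=
  (hf.fderiv_of_isOpen hs (by simp)).clm_apply contDiffOn_const

theorem ContDiff.pd {f : (Fin 3 → ℝ) → ℝ} (hf : ContDiff ℝ (⊤ : ℕ∞) f) (i : Fin 3) :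
    ContDiff ℝ (⊤ : ℕ∞) (pd i f) :=
  contDiffOn_univ.1 ((contDiffOn_univ.2 hf).pd isOpen_univ i)

theorem HasCompactSupport.pd {f : (Fin 3 → ℝ) → ℝ} (hf : HasCompactSupport f) (i : Fin 3) :
    HasCompactSupport (pd i f) :=
  hf.fderiv_apply ℝ _

theorem pd_comm {f : (Fin 3 → ℝ) → ℝ} (hf : ContDiff ℝ (⊤ : ℕ∞) f) (i j : Fin 3)
    (x : Fin 3 → ℝ) : pd i (pd j f) x = pd j (pd i f) x := by
  have hd : DifferentiableAt ℝ (fderiv ℝ f) x :=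
    (hf.fderiv_right (m := (⊤ : ℕ∞)) (by simp)).differentiable (by simp) x
  have h : ∀ k l, _root_.pd k (_root_.pd l f) x =
      fderiv ℝ (fderiv ℝ f) x (Pi.single k 1) (Pi.single l 1) := by
    intro k l
    unfold _root_.pd
    rw [fderiv_clm_apply hd (by fun_prop)]
    simp
  rw [h, h]
  exact (hf.contDiffAt.isSymmSndFDerivAt (by simpa using WithTop.coe_le_coe.2 (le_top : (2 : ℕ∞) ≤ ⊤))) _ _

theorem integral_pd_eq_zero {f : (Fin 3 → ℝ) → ℝ} (hf : ContDiff ℝ (⊤ : ℕ∞) f)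
    (hc : HasCompactSupport f) (i : Fin 3) : ∫ x, pd i f x = 0 := by
  have h := integral_mul_fderiv_eq_neg_fderiv_mul_of_integrable (μ := (volume : Measure (Fin 3 → ℝ)))
    (f := fun _ => (1 : ℝ)) (g := f) (v := Pi.single i 1) (by simp)
    (by
      simp only [one_mul]
      exact (hf.pd i).continuous.integrable_of_hasCompactSupport (hc.pd i))
    (by simpa using hf.continuous.integrable_of_hasCompactSupport hc)
    (fun _ _ => by fun_prop) (fun x _ => hf.differentiable (by simp) x)
  simpa [pd] using h

/-- The `i`-th component of the vector field whose divergence appears in the Carleman identity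
for the conjugated function `w` with weight `exp (τ (K - |x - a|²)² / 4)`. -/
def carlemanField (a : Fin 3 → ℝ) (K τ : ℝ) (w : (Fin 3 → ℝ) → ℝ) (i : Fin 3)
    (x : Fin 3 → ℝ) : ℝ :=
  2 * τ * ((K - sqDist a x) * (pd i w x * ∑ j, (x j - a j) * pd j w x))
    - τ * ((K - sqDist a x) * ((x i - a i) * ∑ j, pd j w x * pd j w x))
    + τ * ((K - 3 * sqDist a x) * (w x * pd i w x))
    + 3 * τ * ((x i - a i) * (w x * w x))
    + τ * ((τ ^ 2 * ((K - sqDist a x) * ((K - sqDist a x) * sqDist a x)) +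
        2 * τ * (K - sqDist a x)) * ((K - sqDist a x) * ((x i - a i) * (w x * w x))))

theorem contDiff_carlemanField (a : Fin 3 → ℝ) (K τ : ℝ) {w : (Fin 3 → ℝ) → ℝ}
    (hw : ContDiff ℝ (⊤ : ℕ∞) w) (i : Fin 3) :
    ContDiff ℝ (⊤ : ℕ∞) (carlemanField a K τ w i) := by
  have h := fun j => hw.pd j
  have hs : ContDiff ℝ (⊤ : ℕ∞) (sqDist a) := contDiff_sqDist a
  unfold carlemanField
  fun_prop

theorem sum_pd_carlemanField (a : Fin 3 → ℝ) (K τ : ℝ) {w : (Fin 3 → ℝ) → ℝ}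
    (hw : ContDiff ℝ (⊤ : ℕ∞) w) (x : Fin 3 → ℝ) {s h Y : ℝ} (hs : s = sqDist a x) (hh : h = K - s)
    (hY : Y = ∑ j, (x j - a j) * pd j w x) :
    (lap w x + (τ ^ 2 * h ^ 2 * s + 2 * τ * h) * w x) * (2 * τ * h * Y + τ * (h - 2 * s) * w x)
      = τ * (4 * Y ^ 2
          + (4 * τ ^ 2 * h ^ 2 * s * (s - h) + 4 * τ * h * (s - h) - 9) * w x ^ 2)
        + ∑ i, pd i (carlemanField a K τ w i) x := by
  have hw0 : ∀ i, HasPd i w (pd i w x) x :=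
    fun i => .of_differentiableAt i (hw.differentiable (by simp) x)
  have hw1 : ∀ i j, HasPd i (pd j w) (pd i (pd j w) x) x :=
    fun i j => .of_differentiableAt i ((hw.pd j).differentiable (by simp) x)
  have hsq := fun i => hasPd_sqDist i a x
  have hy : ∀ i j, HasPd i (fun y => y j - a j) (kron i j) x :=
    fun i j => ((HasPd.coord i j x).sub (.const i (a j) x)).of_eq (by ring)
  have hk : ∀ i, HasPd i (fun y => K - sqDist a y) (-(2 * (x i - a i))) x :=
    fun i => ((HasPd.const i K x).sub (hsq i)).of_eq (by ring)
  have hF : ∀ i, HasPd i (carlemanField a K τ w i) _ x := fun i =>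
    ((((((hk i).mul ((hw1 i i).mul (HasPd.sum fun j => (hy i j).mul (hw1 i j)))).const_mul
      (2 * τ)).sub
    (((hk i).mul ((hy i i).mul (HasPd.sum fun j => (hw1 i j).mul (hw1 i j)))).const_mul τ)).add
    ((((HasPd.const i K x).sub ((hsq i).const_mul 3)).mul ((hw0 i).mul (hw1 i i))).const_mul
      τ)).add
    (((hy i i).mul ((hw0 i).mul (hw0 i))).const_mul (3 * τ))).add
    ((((((hk i).mul ((hk i).mul (hsq i))).const_mul (τ ^ 2)).add ((hk i).const_mul (2 * τ))).mul
      ((hk i).mul ((hy i i).mul ((hw0 i).mul (hw0 i))))).const_mul τ)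
  rw [Finset.sum_congr rfl fun i _ => (hF i).2]
  have e10 := pd_comm hw 1 0 x
  have e20 := pd_comm hw 2 0 x
  have e21 := pd_comm hw 2 1 x
  have hlap : lap w x = pd 0 (pd 0 w) x + pd 1 (pd 1 w) x + pd 2 (pd 2 w) x := by
    simp only [lap, Fin.sum_univ_three]
  have hk0 : ∀ i j, kron i j = if i = j then 1 else 0 := fun _ _ => rfl
  have hs' : sqDist a x = (x 0 - a 0) * (x 0 - a 0) + (x 1 - a 1) * (x 1 - a 1) +
      (x 2 - a 2) * (x 2 - a 2) := by
    simp only [sqDist, Fin.sum_univ_three]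
  subst hh hY hs
  simp only [Fin.sum_univ_three, hk0, hlap, e10, e20, e21, hs', Fin.isValue, if_true,
    Fin.reduceEq, if_false]
  generalize x 0 - a 0 = y0
  generalize x 1 - a 1 = y1
  generalize x 2 - a 2 = y2
  ring

/-- The Carleman weight `exp (τ (K - |x - a|²)² / 4)`. -/
def carlemanWeight (a : Fin 3 → ℝ) (K τ : ℝ) (x : Fin 3 → ℝ) : ℝ :=
  Real.exp (τ / 4 * ((K - sqDist a x) * (K - sqDist a x)))

theorem contDiff_carlemanWeight (a : Fin 3 → ℝ) (K τ : ℝ) {n : WithTop ℕ∞} :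
    ContDiff ℝ n (carlemanWeight a K τ) := by
  have hs : ContDiff ℝ n (sqDist a) := contDiff_sqDist a
  unfold carlemanWeight
  fun_prop

theorem carlemanWeight_mul_lap (a : Fin 3 → ℝ) (K τ : ℝ) {v w : (Fin 3 → ℝ) → ℝ}
    (hv : ContDiff ℝ (⊤ : ℕ∞) v) (hw : w = fun x => carlemanWeight a K τ x * v x)
    (x : Fin 3 → ℝ) {s h : ℝ} (hs : s = sqDist a x) (hh : h = K - s) :
    carlemanWeight a K τ x * lap v x =
      (lap w x + (τ ^ 2 * h ^ 2 * s + 2 * τ * h) * w x)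
      + (2 * τ * h * (∑ j, (x j - a j) * pd j w x) + τ * (h - 2 * s) * w x) := by
  have hk : ∀ i x, HasPd i (fun y => K - sqDist a y) (-(2 * (x i - a i))) x :=
    fun i x => ((HasPd.const i K x).sub (hasPd_sqDist i a x)).of_eq (by ring)
  have hy : ∀ i x, HasPd i (fun y => y i - a i) 1 x :=
    fun i x => ((HasPd.coord i i x).sub (.const i (a i) x)).of_eq (by simp [kron])
  have hW : ∀ i x, HasPd i (carlemanWeight a K τ)
      (carlemanWeight a K τ x * (-τ * ((K - sqDist a x) * (x i - a i)))) x :=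
    fun i x => ((((hk i x).mul (hk i x)).const_mul (τ / 4)).exp).of_eq
      (by unfold carlemanWeight; ring)
  have hv0 : ∀ i x, HasPd i v (pd i v x) x :=
    fun i x => .of_differentiableAt i (hv.differentiable (by simp) x)
  have hv1 : ∀ i j x, HasPd i (pd j v) (pd i (pd j v) x) x :=
    fun i j x => .of_differentiableAt i ((hv.pd j).differentiable (by simp) x)
  have hw0 : ∀ i, pd i w = fun x => carlemanWeight a K τ x *
      (pd i v x - τ * ((K - sqDist a x) * ((x i - a i) * v x))) := by
    intro i
    funext x
    rw [hw, ((hW i x).mul (hv0 i x)).2]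
    ring
  have hw1 := fun i => (congrArg (fun f => pd i f x) (hw0 i)).trans
    ((hW i x).mul ((hv1 i i x).sub (((hk i x).mul ((hy i x).mul (hv0 i x))).const_mul τ))).2
  have hs' : sqDist a x = (x 0 - a 0) * (x 0 - a 0) + (x 1 - a 1) * (x 1 - a 1) +
      (x 2 - a 2) * (x 2 - a 2) := by
    simp only [sqDist, Fin.sum_univ_three]
  have hlw : lap w x = ∑ i, pd i (pd i w) x := rfl
  have hlv : lap v x = ∑ i, pd i (pd i v) x := rfl
  rw [hlw, hlv, Finset.sum_congr rfl fun i _ => hw1 i]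
  subst hh hs
  simp only [Fin.sum_univ_three, hw0, hs']
  rw [hw]
  generalize x 0 - a 0 = y0
  generalize x 1 - a 1 = y1
  generalize x 2 - a 2 = y2
  ring

theorem ContDiff.lap {f : (Fin 3 → ℝ) → ℝ} (hf : ContDiff ℝ (⊤ : ℕ∞) f) :
    ContDiff ℝ (⊤ : ℕ∞) (lap f) := by
  have h : _root_.lap f = fun x => ∑ i, _root_.pd i (_root_.pd i f) x := rfl
  rw [h]
  exact ContDiff.sum fun i _ => (hf.pd i).pd i

theorem HasCompactSupport.lap {f : (Fin 3 → ℝ) → ℝ} (hf : HasCompactSupport f) :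
    HasCompactSupport (lap f) := by
  have h : _root_.lap f = fun x => _root_.pd 0 (_root_.pd 0 f) x + _root_.pd 1 (_root_.pd 1 f) x +
      _root_.pd 2 (_root_.pd 2 f) x := by
    funext x
    simp only [_root_.lap, Fin.sum_univ_three]
  rw [h]
  exact (((hf.pd 0).pd 0).add ((hf.pd 1).pd 1)).add ((hf.pd 2).pd 2)

theorem integrable_sq_mul {f g : (Fin 3 → ℝ) → ℝ} (hf : Continuous f) (hg : Continuous g)
    (hc : HasCompactSupport g) : Integrable (fun x => (f x * g x) ^ 2) :=
  ((hf.mul hg).pow 2).integrable_of_hasCompactSupport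
    (HasCompactSupport.intro hc fun x hx => by simp [image_eq_zero_of_notMem_tsupport hx])

/-- A Carleman estimate for the Laplacian, for functions supported in a spherical shell. -/
theorem carleman_estimate (a : Fin 3 → ℝ) {D τ : ℝ} (hD : 0 < D) (hτ : 50 ≤ τ * D ^ 2)
    {v : (Fin 3 → ℝ) → ℝ} (hv : ContDiff ℝ (⊤ : ℕ∞) v) (hc : HasCompactSupport v)
    (hsupp : ∀ x, v x ≠ 0 → D ≤ sqDist a x ∧ sqDist a x ≤ 9 / 5 * D) :
    τ * ∫ x, (carlemanWeight a (19 / 10 * D) τ x * v x) ^ 2 ≤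
      ∫ x, (carlemanWeight a (19 / 10 * D) τ x * lap v x) ^ 2 := by
  set K := 19 / 10 * D with hK
  set w : (Fin 3 → ℝ) → ℝ := fun x => carlemanWeight a K τ x * v x with hw
  have hτ0 : 0 < τ := by
    by_contra hneg
    nlinarith [sq_nonneg D]
  have hWd : ContDiff ℝ (⊤ : ℕ∞) (carlemanWeight a K τ) := contDiff_carlemanWeight a K τ
  have hwd : ContDiff ℝ (⊤ : ℕ∞) w := hWd.mul hv
  have hwc : HasCompactSupport w := hc.mul_left
  have hFc : ∀ i, HasCompactSupport (carlemanField a K τ w i) := by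
    intro i
    refine HasCompactSupport.intro hwc fun x hx => ?_
    have h0 : w x = 0 := image_eq_zero_of_notMem_tsupport hx
    have h1 : ∀ j, pd j w x = 0 := fun j =>
      image_eq_zero_of_notMem_tsupport fun h => hx (tsupport_fderiv_apply_subset ℝ _ h)
    simp [carlemanField, h0, h1]
  have hFd := contDiff_carlemanField a K τ hwd
  have hpd : ∀ i, Integrable (pd i (carlemanField a K τ w i)) := fun i =>
    ((hFd i).pd i).continuous.integrable_of_hasCompactSupport ((hFc i).pd i)
  have hI1 : Integrable fun x => (carlemanWeight a K τ x * lap v x) ^ 2 :=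
    integrable_sq_mul hWd.continuous hv.lap.continuous hc.lap
  have hI2 : Integrable fun x => (w x) ^ 2 :=
    integrable_sq_mul hWd.continuous hv.continuous hc
  have hpt : ∀ x, τ * (w x) ^ 2 + 2 * ∑ i, pd i (carlemanField a K τ w i) x ≤
      (carlemanWeight a K τ x * lap v x) ^ 2 := by
    intro x
    obtain ⟨s, hs⟩ : ∃ s, s = sqDist a x := ⟨_, rfl⟩
    obtain ⟨h, hh⟩ : ∃ h, h = K - s := ⟨_, rfl⟩
    obtain ⟨Y, hY⟩ : ∃ Y, Y = ∑ j, (x j - a j) * pd j w x := ⟨_, rfl⟩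
    have e1 := sum_pd_carlemanField a K τ hwd x hs hh hY
    have e2 := carlemanWeight_mul_lap a K τ hv hw x hs hh
    rw [← hY] at e2
    rw [e2]
    have key : w x ^ 2 ≤ 2 * (4 * Y ^ 2
          + (4 * τ ^ 2 * h ^ 2 * s * (s - h) + 4 * τ * h * (s - h) - 9) * w x ^ 2) := by
      by_cases hvx : v x = 0
      · have : w x = 0 := by simp [hw, hvx]
        rw [this]
        nlinarith [sq_nonneg Y]
      · obtain ⟨hs1, hs2⟩ := hsupp x hvx
        rw [← hs] at hs1 hs2
        have hh1 : D / 10 ≤ h := by rw [hh, hK]; linarith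
        have hh2 : D / 10 ≤ s - h := by rw [hh, hK]; linarith
        have b1 : (D / 10) ^ 2 * D * (D / 10) ≤ h ^ 2 * s * (s - h) := by
          have := hD.trans_le hs1
          gcongr
        have b2 : (50 : ℝ) ^ 2 ≤ (τ * D ^ 2) ^ 2 := by gcongr
        have b3 : 4 * τ ^ 2 * ((D / 10) ^ 2 * D * (D / 10)) ≤
            4 * τ ^ 2 * (h ^ 2 * s * (s - h)) := by gcongr
        have b4 : 0 ≤ 4 * τ * h * (s - h) :=
          mul_nonneg (mul_nonneg (by positivity) (by linarith)) (by linarith)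
        have b5 : 1 ≤ 4 * τ ^ 2 * h ^ 2 * s * (s - h) + 4 * τ * h * (s - h) - 9 := by
          nlinarith
        nlinarith [sq_nonneg Y, sq_nonneg (w x), mul_le_mul_of_nonneg_right b5 (sq_nonneg (w x))]
    nlinarith [mul_le_mul_of_nonneg_left key hτ0.le,
      sq_nonneg (lap w x + (τ ^ 2 * h ^ 2 * s + 2 * τ * h) * w x),
      sq_nonneg (2 * τ * h * Y + τ * (h - 2 * s) * w x)]
  have hsum : Integrable fun x => ∑ i, pd i (carlemanField a K τ w i) x :=
    integrable_finsetSum _ fun i _ => hpd i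
  have hint := integral_mono ((hI2.const_mul τ).add (hsum.const_mul 2)) hI1 hpt
  have hzero : ∫ x, ∑ i, pd i (carlemanField a K τ w i) x = 0 := by
    rw [integral_finsetSum _ fun i _ => hpd i]
    exact Finset.sum_eq_zero fun i _ => integral_pd_eq_zero (hFd i) (hFc i) i
  simp only [Pi.add_apply] at hint
  rw [integral_add (hI2.const_mul τ) (hsum.const_mul 2), integral_const_mul, integral_const_mul,
    hzero] at hint
  simpa using hint

theorem Filter.EventuallyEq.lap_eq {f g : (Fin 3 → ℝ) → ℝ} {x : Fin 3 → ℝ}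
    (h : f =ᶠ[nhds x] g) : lap f x = lap g x := by
  unfold lap
  refine Finset.sum_congr rfl fun i _ => ?_
  have h1 : (fun y => pd i f y) =ᶠ[nhds x] fun y => pd i g y := by
    filter_upwards [h.fderiv (𝕜 := ℝ)] with y hy
    simp only [pd, hy]
  have h2 := h1.fderiv_eq (𝕜 := ℝ)
  rw [pd, h2, pd]

theorem isCompact_sqDist_le (a : Fin 3 → ℝ) (r : ℝ) : IsCompact {x | sqDist a x ≤ r} := by
  refine Metric.isCompact_of_isClosed_isBounded
    (isClosed_le (contDiff_sqDist a (n := 0)).continuous continuous_const) ?_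
  refine (Metric.isBounded_closedBall (x := a) (r := |r| + 1)).subset fun x hx => ?_
  rw [Metric.mem_closedBall, dist_pi_le_iff (by positivity)]
  intro i
  rw [Real.dist_eq]
  have h1 : (x i - a i) * (x i - a i) ≤ sqDist a x :=
    Finset.single_le_sum (f := fun j => (x j - a j) * (x j - a j))
      (fun j _ => mul_self_nonneg _) (Finset.mem_univ i)
  have h2 : sqDist a x ≤ r := hx
  have h3 := le_abs_self r
  have h4 := abs_nonneg r
  refine abs_le_of_sq_le_sq ?_ (by positivity)
  nlinarith

theorem eq_zero_of_eq_zero_on_ball {Ω : Set (Fin 3 → ℝ)} (hΩ : IsOpen Ω)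
    {u c : (Fin 3 → ℝ) → ℝ} (hu : ContDiffOn ℝ (⊤ : ℕ∞) u Ω) (hc : ContinuousOn c Ω)
    (heq : ∀ x ∈ Ω, lap u x = c x * u x) {a : Fin 3 → ℝ} {D : ℝ} (hD : 0 < D)
    (hsub : ∀ x, sqDist a x ≤ 9 / 5 * D → x ∈ Ω) (h0 : ∀ x, sqDist a x < D → u x = 0) :
    ∀ x, sqDist a x < 8 / 5 * D → u x = 0 := by
  have hsc : Continuous (sqDist a) := (contDiff_sqDist a (n := 0)).continuous
  have hB := isCompact_sqDist_le a (9 / 5 * D)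
  set η : (Fin 3 → ℝ) → ℝ := fun x => Real.smoothTransition ((9 / 5 * D - sqDist a x) * (5 / D))
    with hη
  have hηd : ContDiff ℝ (⊤ : ℕ∞) η := by
    have hs : ContDiff ℝ (⊤ : ℕ∞) (sqDist a) := contDiff_sqDist a
    exact Real.smoothTransition.contDiff.comp (by fun_prop)
  have hη0 : ∀ x, 9 / 5 * D ≤ sqDist a x → η x = 0 := fun x hx =>
    Real.smoothTransition.zero_of_nonpos
      (mul_nonpos_of_nonpos_of_nonneg (by linarith) (by positivity))
  have hη1 : ∀ x, sqDist a x ≤ 8 / 5 * D → η x = 1 := fun x hx =>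
    Real.smoothTransition.one_of_one_le (by
      have h : D / 5 * (5 / D) ≤ (9 / 5 * D - sqDist a x) * (5 / D) := by
        gcongr
        linarith
      have h' : D / 5 * (5 / D) = 1 := by field_simp
      linarith)
  set v : (Fin 3 → ℝ) → ℝ := fun x => η x * u x with hv
  have hvc : HasCompactSupport v :=
    HasCompactSupport.intro hB fun x hx => by
      have : 9 / 5 * D ≤ sqDist a x := (not_le.1 hx).le
      simp [hv, hη0 x this]
  have hvd : ContDiff ℝ (⊤ : ℕ∞) v := by
    rw [contDiff_iff_contDiffAt]
    intro x
    by_cases hx : x ∈ Ω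
    · exact hηd.contDiffAt.mul (hu.contDiffAt (hΩ.mem_nhds hx))
    · have h1 : v =ᶠ[nhds x] fun _ => 0 := by
        have h2 : 9 / 5 * D < sqDist a x := by
          by_contra h
          exact hx (hsub x (not_lt.1 h))
        filter_upwards [(isOpen_lt continuous_const hsc).mem_nhds h2] with y hy
        simp [hv, hη0 y (le_of_lt hy)]
      exact contDiffAt_const.congr_of_eventuallyEq h1
  have hsupp : ∀ x, v x ≠ 0 → D ≤ sqDist a x ∧ sqDist a x ≤ 9 / 5 * D := by
    intro x hx
    constructor
    · by_contra h
      exact hx (by simp [hv, h0 x (not_le.1 h)])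
    · by_contra h
      exact hx (by simp [hv, hη0 x (not_le.1 h).le])
  obtain ⟨M, hM⟩ : ∃ M, ∀ x ∈ {x | sqDist a x ≤ 9 / 5 * D}, ‖c x‖ ≤ M :=
    hB.exists_bound_of_continuousOn (hc.mono fun x hx => hsub x hx)
  set A : Set (Fin 3 → ℝ) := {x | sqDist a x < 8 / 5 * D} with hA
  have hAo : IsOpen A := isOpen_lt hsc continuous_const
  have hvA : ∀ x ∈ A, v x = u x := fun x hx => by simp [hv, hη1 x (le_of_lt hx)]
  have hlapA : ∀ x ∈ A, (lap v x) ^ 2 ≤ M ^ 2 * (v x) ^ 2 := by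
    intro x hx
    have hx' : sqDist a x ≤ 9 / 5 * D := by
      have : sqDist a x < 8 / 5 * D := hx
      linarith
    have h1 : v =ᶠ[nhds x] u := by
      filter_upwards [hAo.mem_nhds hx] with y hy using hvA y hy
    rw [h1.lap_eq, heq x (hsub x hx'), hvA x hx, mul_pow]
    have h2 : c x ^ 2 ≤ M ^ 2 := sq_le_sq' (by linarith [neg_le_of_abs_le (hM x hx')])
      (le_of_abs_le (hM x hx'))
    exact mul_le_mul_of_nonneg_right h2 (sq_nonneg _)
  have hI0 : Integrable fun x => (lap v x) ^ 2 := by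
    simpa using integrable_sq_mul (f := fun _ => 1) continuous_const hvd.lap.continuous hvc.lap
  have hI3 : Integrable fun x => (v x) ^ 2 := by
    simpa using integrable_sq_mul (f := fun _ => 1) continuous_const hvd.continuous hvc
  have hbound : ∀ τ, 50 ≤ τ * D ^ 2 → M ^ 2 ≤ τ →
      (τ - M ^ 2) * ∫ x in A, (v x) ^ 2 ≤ ∫ x, (lap v x) ^ 2 := by
    intro τ hτ hτM
    have hτ0 : 0 ≤ τ := (sq_nonneg M).trans hτM
    set W := carlemanWeight a (19 / 10 * D) τ with hW
    set W₁ := Real.exp (τ / 4 * ((3 / 10 * D) * (3 / 10 * D))) with hW₁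
    have hWc : Continuous W := (contDiff_carlemanWeight a _ τ (n := 0)).continuous
    have hI1 : Integrable fun x => (W x * lap v x) ^ 2 :=
      integrable_sq_mul hWc hvd.lap.continuous hvc.lap
    have hI2 : Integrable fun x => (W x * v x) ^ 2 :=
      integrable_sq_mul hWc hvd.continuous hvc
    have hpt : ∀ x, (W x * lap v x) ^ 2 ≤ M ^ 2 * (W x * v x) ^ 2 + W₁ ^ 2 * (lap v x) ^ 2 := by
      intro x
      by_cases hx : x ∈ A
      · have := mul_le_mul_of_nonneg_left (hlapA x hx) (sq_nonneg (W x))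
        nlinarith [mul_nonneg (sq_nonneg W₁) (sq_nonneg (lap v x))]
      · by_cases hx2 : lap v x = 0
        · rw [hx2]
          have := mul_nonneg (sq_nonneg M) (sq_nonneg (W x * v x))
          simpa using this
        · have h1 : sqDist a x ≤ 9 / 5 * D := by
            by_contra h
            refine hx2 ?_
            have h1 : v =ᶠ[nhds x] fun _ => 0 := by
              filter_upwards [(isOpen_lt continuous_const hsc).mem_nhds (not_le.1 h)] with y hy
              simp [hv, hη0 y (le_of_lt hy)]
            rw [h1.lap_eq]
            simp [lap, pd]
          have h2 : 8 / 5 * D ≤ sqDist a x := not_lt.1 hx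
          have h3 : W x ≤ W₁ := by
            refine Real.exp_le_exp.2 (mul_le_mul_of_nonneg_left ?_ (by positivity))
            have : 19 / 10 * D - sqDist a x ≤ 3 / 10 * D := by linarith
            have : 0 ≤ 19 / 10 * D - sqDist a x := by linarith
            gcongr
          have h4 : W x ^ 2 ≤ W₁ ^ 2 := pow_le_pow_left₀ (Real.exp_pos _).le h3 2
          have := mul_le_mul_of_nonneg_right h4 (sq_nonneg (lap v x))
          nlinarith [mul_nonneg (sq_nonneg M) (sq_nonneg (W x * v x))]
    have e1 := carleman_estimate a hD hτ hvd hvc hsupp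
    have e2 := integral_mono hI1 ((hI2.const_mul (M ^ 2)).add (hI0.const_mul (W₁ ^ 2))) hpt
    simp only [Pi.add_apply] at e2
    rw [integral_add (hI2.const_mul _) (hI0.const_mul _), integral_const_mul,
      integral_const_mul] at e2
    have e3 : W₁ ^ 2 * ∫ x in A, (v x) ^ 2 ≤ ∫ x, (W x * v x) ^ 2 := by
      rw [← integral_const_mul]
      refine (setIntegral_mono_on (hI3.const_mul _).integrableOn hI2.integrableOn
        hAo.measurableSet fun x hx => ?_).trans
        (setIntegral_le_integral hI2 (Filter.Eventually.of_forall fun x => sq_nonneg _))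
      have hx' : sqDist a x < 8 / 5 * D := hx
      rw [mul_pow (W x)]
      have h3 : W₁ ≤ W x := by
        refine Real.exp_le_exp.2 (mul_le_mul_of_nonneg_left ?_ (by positivity))
        have h4 : 3 / 10 * D ≤ 19 / 10 * D - sqDist a x := by linarith
        exact mul_self_le_mul_self (by positivity) h4
      exact mul_le_mul_of_nonneg_right (pow_le_pow_left₀ (Real.exp_pos _).le h3 2) (sq_nonneg _)
    have e4 := mul_le_mul_of_nonneg_left e3 (sub_nonneg.2 hτM)
    have hpos : 0 < W₁ ^ 2 := pow_pos (Real.exp_pos _) 2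
    refine le_of_mul_le_mul_left ?_ hpos
    linarith
  have hzero : ∫ x in A, (v x) ^ 2 = 0 := by
    have hnn : 0 ≤ ∫ x in A, (v x) ^ 2 := integral_nonneg fun x => sq_nonneg _
    by_contra hne
    have hpos : 0 < ∫ x in A, (v x) ^ 2 := lt_of_le_of_ne hnn (Ne.symm hne)
    have hC : 0 ≤ ∫ x, (lap v x) ^ 2 := integral_nonneg fun x => sq_nonneg _
    set I := ∫ x in A, (v x) ^ 2
    set C := ∫ x, (lap v x) ^ 2
    have hDpos : 0 < 50 / D ^ 2 := by positivity
    have hCI : 0 < (C + 1) / I := by positivity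
    have h := hbound (M ^ 2 + 50 / D ^ 2 + (C + 1) / I) (by
      have : 50 / D ^ 2 * D ^ 2 = 50 := by field_simp
      nlinarith [mul_nonneg (sq_nonneg M) (sq_nonneg D), mul_nonneg hCI.le (sq_nonneg D)])
      (by linarith)
    have h2 : (C + 1) / I * I = C + 1 := by field_simp
    nlinarith
  have hae := (setIntegral_eq_zero_iff_of_nonneg_ae
    (Filter.Eventually.of_forall fun x => sq_nonneg (v x)) hI3.integrableOn).1 hzero
  have hEq := Measure.eqOn_open_of_ae_eq hae hAo (hvd.continuous.pow 2).continuousOn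
    continuousOn_const
  intro x hx
  have := hEq (show x ∈ A from hx)
  rw [← hvA x hx]
  simpa using this

/-- Weak unique continuation for the Schrödinger equation `Δu = c u` on a connected open set. -/
theorem eq_zero_of_lap_eq_mul {Ω : Set (Fin 3 → ℝ)} (hΩ : IsOpen Ω) (hconn : IsPreconnected Ω)
    {u c : (Fin 3 → ℝ) → ℝ} (hu : ContDiffOn ℝ (⊤ : ℕ∞) u Ω) (hc : ContinuousOn c Ω)
    (heq : ∀ x ∈ Ω, lap u x = c x * u x) {O : Set (Fin 3 → ℝ)} (hO : IsOpen O)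
    (hne : (Ω ∩ O).Nonempty) (h0 : ∀ x ∈ Ω ∩ O, u x = 0) : ∀ x ∈ Ω, u x = 0 := by
  set V := interior {x | x ∈ Ω ∧ u x = 0} with hV
  have hVs : ∀ x ∈ V, x ∈ Ω ∧ u x = 0 := fun x hx =>
    (show V ⊆ {x | x ∈ Ω ∧ u x = 0} from interior_subset) hx
  suffices h : Ω ⊆ V from fun x hx => (hVs x (h hx)).2
  refine hconn.subset_of_closure_inter_subset isOpen_interior ?_ ?_
  · obtain ⟨x, hx⟩ := hne
    exact ⟨x, hx.1, mem_interior.2 ⟨Ω ∩ O, fun y hy => ⟨hy.1, h0 y hy⟩, hΩ.inter hO, hx⟩⟩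
  rintro p ⟨hpV, hpΩ⟩
  by_contra hp
  obtain ⟨ε, hε, hball⟩ := Metric.isOpen_iff.1 hΩ p hpΩ
  have hsc : ∀ b, Continuous (sqDist b) := fun b => (contDiff_sqDist b (n := 0)).continuous
  have hself : ∀ b, sqDist b b = 0 := fun b => by simp [sqDist]
  obtain ⟨a, haS, haV⟩ := mem_closure_iff.1 hpV {x | sqDist p x < ε ^ 2 / 6}
    (isOpen_lt (hsc p) continuous_const) (by
      change sqDist p p < _
      rw [hself]
      positivity)
  have hsymm : sqDist a p = sqDist p a := by
    simp only [sqDist]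
    exact Finset.sum_congr rfl fun j _ => by ring
  have hap : sqDist a p < ε ^ 2 / 6 := hsymm ▸ haS
  obtain ⟨p', ⟨hp'1, hp'2⟩, hmin⟩ := ((isCompact_sqDist_le a (sqDist a p)).inter_right
    (isOpen_interior (s := {x | x ∈ Ω ∧ u x = 0})).isClosed_compl).exists_isMinOn
    ⟨p, le_refl (sqDist a p), hp⟩ (hsc a).continuousOn
  have hle : sqDist a p' ≤ sqDist a p := hp'1
  have hinV : ∀ x, sqDist a x < sqDist a p' → x ∈ V := by
    intro x hx
    by_contra hxV
    exact absurd (hmin ⟨hx.le.trans hle, hxV⟩) (not_le.2 hx)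
  have hnn : ∀ x, 0 ≤ sqDist a x := fun x => Finset.sum_nonneg fun j _ => mul_self_nonneg _
  have hD : 0 < sqDist a p' := by
    refine lt_of_le_of_ne (hnn p') fun h => hp'2 ?_
    have h1 : ∀ j, p' j = a j := by
      intro j
      have h2 := (Finset.sum_eq_zero_iff_of_nonneg (s := Finset.univ)
        (f := fun j => (p' j - a j) * (p' j - a j)) (fun j _ => mul_self_nonneg _)).1 h.symm j
        (Finset.mem_univ j)
      exact sub_eq_zero.1 (mul_self_eq_zero.1 h2)
    rw [funext h1]
    exact haV
  have hsub : ∀ x, sqDist a x ≤ 9 / 5 * sqDist a p' → x ∈ Ω := by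
    intro x hx
    refine hball ?_
    rw [Metric.mem_ball, dist_pi_lt_iff hε]
    intro i
    rw [Real.dist_eq]
    refine abs_lt_of_sq_lt_sq ?_ hε.le
    have h1 := Finset.single_le_sum (f := fun j => (x j - a j) * (x j - a j))
      (fun j _ => mul_self_nonneg _) (Finset.mem_univ i)
    have h2 := Finset.single_le_sum (f := fun j => (p j - a j) * (p j - a j))
      (fun j _ => mul_self_nonneg _) (Finset.mem_univ i)
    change _ ≤ sqDist a x at h1
    change _ ≤ sqDist a p at h2
    nlinarith [sq_nonneg ((x i - a i) + (p i - a i))]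
  have hu0 := eq_zero_of_eq_zero_on_ball hΩ hu hc heq hD hsub fun x hx => (hVs x (hinV x hx)).2
  refine hp'2 (mem_interior.2 ⟨{x | sqDist a x < 8 / 5 * sqDist a p'}, fun x hx => ?_,
    isOpen_lt (hsc a) continuous_const, ?_⟩)
  · have hx' : sqDist a x < 8 / 5 * sqDist a p' := hx
    exact ⟨hsub x (by linarith), hu0 x hx⟩
  · change sqDist a p' < 8 / 5 * sqDist a p'
    linarith

theorem lap_eq_sum {Ω : Set (Fin 3 → ℝ)} (hΩ : IsOpen Ω) {f : (Fin 3 → ℝ) → ℝ}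
    {f' : Fin 3 → (Fin 3 → ℝ) → ℝ} {f'' : Fin 3 → ℝ} {x : Fin 3 → ℝ} (hx : x ∈ Ω)
    (h1 : ∀ i, ∀ y ∈ Ω, HasPd i f (f' i y) y) (h2 : ∀ i, HasPd i (f' i) (f'' i) x) :
    lap f x = ∑ i, f'' i := by
  refine Finset.sum_congr rfl fun i _ => ((h2 i).congr_of_eventuallyEq ?_).2
  filter_upwards [hΩ.mem_nhds hx] with y hy using (h1 i y hy).2.symm

section LocalCalculus

variable {Ω : Set (Fin 3 → ℝ)} {f g : (Fin 3 → ℝ) → ℝ} {x : Fin 3 → ℝ}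

theorem ContDiffOn.hasPd (hΩ : IsOpen Ω) (hf : ContDiffOn ℝ (⊤ : ℕ∞) f Ω) (hx : x ∈ Ω)
    (i : Fin 3) : HasPd i f (_root_.pd i f x) x :=
  .of_differentiableAt i ((hf.contDiffAt (hΩ.mem_nhds hx)).differentiableAt (by simp))

theorem lap_linear_combination (hΩ : IsOpen Ω) (hf : ContDiffOn ℝ (⊤ : ℕ∞) f Ω)
    (hg : ContDiffOn ℝ (⊤ : ℕ∞) g Ω) (hx : x ∈ Ω) (a b : ℝ) :
    lap (fun y => a * f y + b * g y) x = a * lap f x + b * lap g x := by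
  rw [lap_eq_sum hΩ hx
    (fun i y hy => ((hf.hasPd hΩ hy i).const_mul a).add ((hg.hasPd hΩ hy i).const_mul b))
    (fun i => (((hf.pd hΩ i).hasPd hΩ hx i).const_mul a).add
      (((hg.pd hΩ i).hasPd hΩ hx i).const_mul b)), Finset.sum_add_distrib,
    ← Finset.mul_sum, ← Finset.mul_sum]
  rfl

theorem lap_mul_self (hΩ : IsOpen Ω) (hf : ContDiffOn ℝ (⊤ : ℕ∞) f Ω) (hx : x ∈ Ω) :
    lap (fun y => f y * f y) x = 2 * (f x * lap f x + ∑ i, pd i f x ^ 2) := by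
  rw [lap_eq_sum hΩ hx (fun i y hy => (hf.hasPd hΩ hy i).mul (hf.hasPd hΩ hy i))
    (fun i => (((hf.hasPd hΩ hx i).mul ((hf.pd hΩ i).hasPd hΩ hx i)).add
      ((hf.hasPd hΩ hx i).mul ((hf.pd hΩ i).hasPd hΩ hx i))))]
  simp only [lap, Fin.sum_univ_three]
  ring

theorem exists_eq_const_of_pd_eq_zero (hΩ : IsOpen Ω) (hconn : IsPreconnected Ω)
    (hf : ∀ x ∈ Ω, ∀ i, HasPd i f 0 x) : ∃ k, ∀ x ∈ Ω, f x = k := by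
  refine hΩ.exists_is_const_of_fderiv_eq_zero (𝕜 := ℝ) hconn
    (fun x hx => (hf x hx 0).1.differentiableWithinAt) fun x hx => ?_
  have h : ∀ i, fderiv ℝ f x (Pi.single i 1) = 0 := fun i => (hf x hx i).2
  refine ContinuousLinearMap.coe_injective (LinearMap.pi_ext' fun i => LinearMap.ext_ring ?_)
  simpa using h i

end LocalCalculus

theorem hasPd_div_eq_zero {i : Fin 3} {f g : (Fin 3 → ℝ) → ℝ} {f' g' : ℝ} {x : Fin 3 → ℝ}
    (hf : HasPd i f f' x) (hg : HasPd i g g' x) (h0 : g x ≠ 0) (h : g x * f' = f x * g') :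
    HasPd i (fun y => f y / g y) 0 x := by
  have hd : DifferentiableAt ℝ (fun y => f y / g y) x := by
    simp only [div_eq_mul_inv]
    exact hf.1.mul (hg.1.inv h0)
  have hq := HasPd.of_differentiableAt i hd
  have h1 : HasPd i f (g x * pd i (fun y => f y / g y) x + f x / g x * g') x := by
    refine (hg.mul hq).congr_of_eventuallyEq ?_
    filter_upwards [hg.1.continuousAt.eventually_ne h0] with y hy
    field_simp
  have h2 : f' = g x * pd i (fun y => f y / g y) x + f x / g x * g' := hf.2.symm.trans h1.2
  refine hq.of_eq ?_
  have h3 : g x * g x * pd i (fun y => f y / g y) x = 0 := by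
    have h4 : f x / g x * g x = f x := by field_simp
    linear_combination (-g x) * h2 + h - g' * h4
  simpa [h0] using h3

section Algebra

theorem sqrt_six_eq : Real.sqrt 6 = 2 * Real.sqrt (3 / 2) := by
  rw [Real.sqrt_eq_iff_mul_self_eq (by norm_num) (by positivity)]
  nlinarith [Real.sq_sqrt (show (0 : ℝ) ≤ 3 / 2 by norm_num)]

theorem sq_sqrt_three_halves : Real.sqrt (3 / 2) ^ 2 = 3 / 2 := Real.sq_sqrt (by norm_num)

theorem sq_sqrt_half : Real.sqrt (1 / 2) ^ 2 = 1 / 2 := Real.sq_sqrt (by norm_num)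

theorem E_combination (a b c : ℝ) : a • E1 + b • E2 + c • E3 =
    !![-(Real.sqrt (3 / 2) / 3) * a + Real.sqrt (1 / 2) * b, Real.sqrt (1 / 2) * c, 0;
      Real.sqrt (1 / 2) * c, -(Real.sqrt (3 / 2) / 3) * a - Real.sqrt (1 / 2) * b, 0;
      0, 0, 2 * Real.sqrt (3 / 2) / 3 * a] := by
  ext i j
  fin_cases i <;> fin_cases j <;> simp [E1, E2, E3] <;> ring

variable (q₁ q₂ q₃ : (Fin 3 → ℝ) → ℝ) (x : Fin 3 → ℝ)

theorem Qz_eq : Qz q₁ q₂ q₃ x =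
    !![-(Real.sqrt (3 / 2) / 3) * q₁ x + Real.sqrt (1 / 2) * q₂ x, Real.sqrt (1 / 2) * q₃ x, 0;
      Real.sqrt (1 / 2) * q₃ x, -(Real.sqrt (3 / 2) / 3) * q₁ x - Real.sqrt (1 / 2) * q₂ x, 0;
      0, 0, 2 * Real.sqrt (3 / 2) / 3 * q₁ x] :=
  E_combination _ _ _

theorem Qz_eq_zero_of (h1 : q₁ x = 0) (h2 : q₂ x = 0) (h3 : q₃ x = 0) : Qz q₁ q₂ q₃ x = 0 := by
  simp [Qz, h1, h2, h3]

theorem trQ2_Qz : trQ2 (Qz q₁ q₂ q₃) x = q₁ x ^ 2 + q₂ x ^ 2 + q₃ x ^ 2 := by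
  simp only [trQ2, Qz_eq, Fin.sum_univ_three]
  simp only [of_apply, cons_val', cons_val_fin_one, cons_val, Fin.isValue]
  linear_combination (2 / 3 * q₁ x ^ 2) * sq_sqrt_three_halves +
    (2 * q₂ x ^ 2 + 2 * q₃ x ^ 2) * sq_sqrt_half

theorem trace_Qz_sq : (Qz q₁ q₂ q₃ x * Qz q₁ q₂ q₃ x).trace = q₁ x ^ 2 + q₂ x ^ 2 + q₃ x ^ 2 := by
  rw [← trQ2_Qz]
  simp [trace, trQ2, mul_apply]

theorem trace_Qz_cube : (Qz q₁ q₂ q₃ x * Qz q₁ q₂ q₃ x * Qz q₁ q₂ q₃ x).trace =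
    Real.sqrt (3 / 2) / 3 * (q₁ x ^ 3 - 3 * q₁ x * (q₂ x ^ 2 + q₃ x ^ 2)) := by
  simp only [trace_fin_three, mul_apply, Qz_eq, Fin.sum_univ_three]
  simp only [of_apply, cons_val', cons_val_fin_one, cons_val, Fin.isValue]
  linear_combination (2 / 9 * Real.sqrt (3 / 2) * q₁ x ^ 3) * sq_sqrt_three_halves -
    (2 * Real.sqrt (3 / 2) * q₁ x * (q₂ x ^ 2 + q₃ x ^ 2)) * sq_sqrt_half

variable {q₁ q₂ q₃ x}

theorem uniaxial_cases (h : ((Qz q₁ q₂ q₃ x * Qz q₁ q₂ q₃ x).trace) ^ 3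
        = 6 * ((Qz q₁ q₂ q₃ x * Qz q₁ q₂ q₃ x * Qz q₁ q₂ q₃ x).trace) ^ 2) :
    q₂ x ^ 2 + q₃ x ^ 2 = 0 ∨ 3 * q₁ x ^ 2 = q₂ x ^ 2 + q₃ x ^ 2 := by
  rw [trace_Qz_sq, trace_Qz_cube] at h
  have h2 : (q₂ x ^ 2 + q₃ x ^ 2) * (3 * q₁ x ^ 2 - (q₂ x ^ 2 + q₃ x ^ 2)) ^ 2 = 0 := by
    linear_combination h + (6 / 9 * (q₁ x ^ 3 - 3 * q₁ x * (q₂ x ^ 2 + q₃ x ^ 2)) ^ 2) *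
      sq_sqrt_three_halves
  rcases mul_eq_zero.1 h2 with h3 | h3
  · exact .inl h3
  · exact .inr (sub_eq_zero.1 (pow_eq_zero_iff (by norm_num) |>.1 h3))

/-- If `(q₂, q₃)` stays parallel to `(α, β)`, the matrices `q₁E₁ + q₂E₂ + q₃E₃` have a common
orthonormal eigenbasis. -/
theorem exists_common_frame {α β : ℝ} (h : α ≠ 0 ∨ β ≠ 0) :
    ∃ v : Fin 3 → Fin 3 → ℝ, (∀ i j : Fin 3, (∑ k : Fin 3, v i k * v j k) = kron i j) ∧
      ∀ a b c : ℝ, β * b = α * c →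
        ∀ i, ∃ μ : ℝ, (a • E1 + b • E2 + c • E3).mulVec (v i) = μ • v i := by
  obtain ⟨ρ, θ, hρ, hα, hβ⟩ : ∃ ρ θ : ℝ, ρ ≠ 0 ∧ α = ρ * Real.cos (2 * θ) ∧
      β = ρ * Real.sin (2 * θ) := by
    refine ⟨‖(⟨α, β⟩ : ℂ)‖, Complex.arg ⟨α, β⟩ / 2, ?_, ?_, ?_⟩
    · rw [norm_ne_zero_iff, ne_eq, Complex.ext_iff]
      exact fun h0 => h.elim (· h0.1) (· h0.2)
    · rw [mul_div_cancel₀ _ (by norm_num), Complex.norm_mul_cos_arg]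
    · rw [mul_div_cancel₀ _ (by norm_num), Complex.norm_mul_sin_arg]
  have hcs := Real.cos_sq_add_sin_sq θ
  rw [Real.cos_two_mul'] at hα
  rw [Real.sin_two_mul] at hβ
  set c := Real.cos θ
  set s := Real.sin θ
  refine ⟨![![c, s, 0], ![-s, c, 0], ![0, 0, 1]], ?_, ?_⟩
  · intro i j
    fin_cases i <;> fin_cases j <;> simp [kron, Fin.sum_univ_three] <;> linarith
  intro q₁ q₂ q₃ hq
  have hq' : q₂ * (2 * s * c) = q₃ * (c ^ 2 - s ^ 2) :=
    mul_left_cancel₀ hρ (by linear_combination hq - q₂ * hβ + q₃ * hα)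
  obtain ⟨k, hk⟩ : ∃ k, k = q₂ * (c ^ 2 - s ^ 2) + q₃ * (2 * s * c) := ⟨_, rfl⟩
  have e2 : q₂ = k * (c ^ 2 - s ^ 2) := by
    rw [hk]
    linear_combination (2 * s * c) * hq' - q₂ * (c ^ 2 + s ^ 2 + 1) * hcs
  have e3 : q₃ = k * (2 * s * c) := by
    rw [hk]
    linear_combination (-(c ^ 2 - s ^ 2)) * hq' - q₃ * (c ^ 2 + s ^ 2 + 1) * hcs
  have f1 : q₂ * c + q₃ * s = k * c := by rw [e2, e3]; linear_combination k * c * hcs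
  have f2 : q₃ * c - q₂ * s = k * s := by rw [e2, e3]; linear_combination k * s * hcs
  rw [E_combination]
  generalize Real.sqrt (3 / 2) = a
  generalize Real.sqrt (1 / 2) = b
  intro i
  fin_cases i
  · refine ⟨-(a / 3) * q₁ + b * k, ?_⟩
    ext j
    fin_cases j <;> simp [mulVec, dotProduct, Fin.sum_univ_three]
    · linear_combination b * f1
    · linear_combination b * f2
  · refine ⟨-(a / 3) * q₁ - b * k, ?_⟩
    ext j
    fin_cases j <;> simp [mulVec, dotProduct, Fin.sum_univ_three]
    · linear_combination b * f2
    · linear_combination (-b) * f1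
  · refine ⟨2 * a / 3 * q₁, ?_⟩
    ext j
    fin_cases j <;> simp [mulVec, dotProduct, Fin.sum_univ_three]

end Algebra

section EulerLagrange

variable {t : ℝ} {Ω : Set (Fin 3 → ℝ)} {q₁ q₂ q₃ : (Fin 3 → ℝ) → ℝ}

/-- The scalar potential `c` in the equations `Δq₂ = c q₂`, `Δq₃ = c q₃`. -/
def potential (t : ℝ) (q₁ q₂ q₃ : (Fin 3 → ℝ) → ℝ) (x : Fin 3 → ℝ) : ℝ :=
  t + 6 * q₁ x + 2 * (q₁ x ^ 2 + q₂ x ^ 2 + q₃ x ^ 2)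

theorem LdG_EL.scalar_equations (hΩ : IsOpen Ω) (h1 : ContDiffOn ℝ (⊤ : ℕ∞) q₁ Ω)
    (h2 : ContDiffOn ℝ (⊤ : ℕ∞) q₂ Ω) (h3 : ContDiffOn ℝ (⊤ : ℕ∞) q₃ Ω)
    (hEL : LdG_EL t Ω (Qz q₁ q₂ q₃)) {x : Fin 3 → ℝ} (hx : x ∈ Ω) :
    lap q₁ x = t * q₁ x - 3 * (q₁ x ^ 2 - (q₂ x ^ 2 + q₃ x ^ 2)) +
      2 * q₁ x * (q₁ x ^ 2 + q₂ x ^ 2 + q₃ x ^ 2) ∧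
    lap q₂ x = potential t q₁ q₂ q₃ x * q₂ x ∧ lap q₃ x = potential t q₁ q₂ q₃ x * q₃ x := by
  have ha0 : Real.sqrt (3 / 2) ≠ 0 := by positivity
  have hb0 : Real.sqrt (1 / 2) ≠ 0 := by positivity
  have ha2 := sq_sqrt_three_halves
  have l00 : lap (fun y => Qz q₁ q₂ q₃ y 0 0) x =
      -(Real.sqrt (3 / 2) / 3) * lap q₁ x + Real.sqrt (1 / 2) * lap q₂ x := by
    rw [← lap_linear_combination hΩ h1 h2 hx]
    simp [Qz_eq]
  have l11 : lap (fun y => Qz q₁ q₂ q₃ y 1 1) x =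
      -(Real.sqrt (3 / 2) / 3) * lap q₁ x + (-Real.sqrt (1 / 2)) * lap q₂ x := by
    rw [← lap_linear_combination hΩ h1 h2 hx]
    simp [Qz_eq, sub_eq_add_neg]
  have l01 : lap (fun y => Qz q₁ q₂ q₃ y 0 1) x = 0 * lap q₁ x + Real.sqrt (1 / 2) * lap q₃ x := by
    rw [← lap_linear_combination hΩ h1 h3 hx]
    simp [Qz_eq]
  have l22 : lap (fun y => Qz q₁ q₂ q₃ y 2 2) x =
      2 * Real.sqrt (3 / 2) / 3 * lap q₁ x + 0 * lap q₃ x := by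
    rw [← lap_linear_combination hΩ h1 h3 hx]
    simp [Qz_eq]
  have e00 := hEL x hx 0 0
  have e11 := hEL x hx 1 1
  have e01 := hEL x hx 0 1
  have e22 := hEL x hx 2 2
  rw [l00] at e00
  rw [l11] at e11
  rw [l01] at e01
  rw [l22] at e22
  rw [trQ2_Qz, sqrt_six_eq, Qz_eq] at e00 e11 e01 e22
  simp only [kron, Fin.sum_univ_three, of_apply, cons_val', cons_val_fin_one, cons_val,
    Fin.isValue, if_true, Fin.reduceEq, if_false]
    at e00 e11 e01 e22
  unfold potential
  set a := Real.sqrt (3 / 2)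
  set b := Real.sqrt (1 / 2)
  refine ⟨mul_left_cancel₀ ha0 ?_, mul_left_cancel₀ hb0 ?_, mul_left_cancel₀ hb0 ?_⟩
  · linear_combination 3 / 2 * e22 - 4 * a * q₁ x ^ 2 * ha2
  · linear_combination (e00 - e11) / 2 + 4 * b * q₁ x * q₂ x * ha2
  · linear_combination e01 + 4 * b * q₁ x * q₃ x * ha2

theorem cross_gradient_eq_zero (hΩ : IsOpen Ω) (h1 : ContDiffOn ℝ (⊤ : ℕ∞) q₁ Ω)
    (h2 : ContDiffOn ℝ (⊤ : ℕ∞) q₂ Ω) (h3 : ContDiffOn ℝ (⊤ : ℕ∞) q₃ Ω)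
    {c : ℝ} (hB : ∀ x ∈ Ω, 3 * q₁ x ^ 2 = q₂ x ^ 2 + q₃ x ^ 2) {x : Fin 3 → ℝ} (hx : x ∈ Ω)
    (e1 : lap q₁ x = c * q₁ x) (e2 : lap q₂ x = c * q₂ x) (e3 : lap q₃ x = c * q₃ x) (i : Fin 3) :
    3 * (q₁ x * pd i q₁ x) = q₂ x * pd i q₂ x + q₃ x * pd i q₃ x ∧
      q₂ x * pd i q₃ x = q₃ x * pd i q₂ x := by
  have hnhds : (fun y => 3 * (q₁ y * q₁ y)) =ᶠ[nhds x]
      fun y => 1 * (q₂ y * q₂ y) + 1 * (q₃ y * q₃ y) := by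
    filter_upwards [hΩ.mem_nhds hx] with y hy
    linarith [hB y hy]
  have hgrad : ∀ j, 3 * (q₁ x * pd j q₁ x) = q₂ x * pd j q₂ x + q₃ x * pd j q₃ x := by
    intro j
    have d1 := h1.hasPd hΩ hx j
    have d2 := h2.hasPd hΩ hx j
    have d3 := h3.hasPd hΩ hx j
    have := (((d1.mul d1).const_mul 3).congr_of_eventuallyEq hnhds).2.symm.trans
      (((d2.mul d2).const_mul 1).add ((d3.mul d3).const_mul 1)).2
    linarith
  have hlap : 3 * lap (fun y => q₁ y * q₁ y) x =
      lap (fun y => q₂ y * q₂ y) x + lap (fun y => q₃ y * q₃ y) x := by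
    have k1 := lap_linear_combination hΩ (h1.mul h1) (h1.mul h1) hx 3 0
    have k2 := lap_linear_combination hΩ (h2.mul h2) (h3.mul h3) hx 1 1
    have k3 := hnhds.lap_eq
    simp only [zero_mul, add_zero] at k1
    rw [k1, k2] at k3
    linarith
  rw [lap_mul_self hΩ h1 hx, lap_mul_self hΩ h2 hx, lap_mul_self hΩ h3 hx, e1, e2, e3] at hlap
  have hx3 := hB x hx
  have hsum : ∑ j, (q₂ x * pd j q₃ x - q₃ x * pd j q₂ x) ^ 2 = 0 := by
    have g0 := hgrad 0
    have g1 := hgrad 1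
    have g2 := hgrad 2
    simp only [Fin.sum_univ_three] at hlap ⊢
    have hn : 3 * (pd 0 q₁ x ^ 2 + pd 1 q₁ x ^ 2 + pd 2 q₁ x ^ 2) =
        pd 0 q₂ x ^ 2 + pd 1 q₂ x ^ 2 + pd 2 q₂ x ^ 2 +
          (pd 0 q₃ x ^ 2 + pd 1 q₃ x ^ 2 + pd 2 q₃ x ^ 2) := by
      linear_combination hlap / 2 - c * hx3
    linear_combination (-(q₂ x ^ 2 + q₃ x ^ 2)) * hn
      - 3 * (pd 0 q₁ x ^ 2 + pd 1 q₁ x ^ 2 + pd 2 q₁ x ^ 2) * hx3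
      + (3 * (q₁ x * pd 0 q₁ x) + (q₂ x * pd 0 q₂ x + q₃ x * pd 0 q₃ x)) * g0
      + (3 * (q₁ x * pd 1 q₁ x) + (q₂ x * pd 1 q₂ x + q₃ x * pd 1 q₃ x)) * g1
      + (3 * (q₁ x * pd 2 q₁ x) + (q₂ x * pd 2 q₂ x + q₃ x * pd 2 q₃ x)) * g2
  have hi := (Finset.sum_eq_zero_iff_of_nonneg fun j _ => sq_nonneg _).1 hsum i (Finset.mem_univ i)
  exact ⟨hgrad i, sub_eq_zero.1 (pow_eq_zero_iff (by norm_num) |>.1 hi)⟩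

/-- On a connected open set where `Q ≠ 0` is uniaxial, `(q₂, q₃)` has constant direction. -/
theorem exists_direction (hΩ : IsOpen Ω) (hconn : IsPreconnected Ω)
    (h1 : ContDiffOn ℝ (⊤ : ℕ∞) q₁ Ω) (h2 : ContDiffOn ℝ (⊤ : ℕ∞) q₂ Ω)
    (h3 : ContDiffOn ℝ (⊤ : ℕ∞) q₃ Ω) (hEL : LdG_EL t Ω (Qz q₁ q₂ q₃))
    (hcases : ∀ x ∈ Ω, q₂ x ^ 2 + q₃ x ^ 2 = 0 ∨ 3 * q₁ x ^ 2 = q₂ x ^ 2 + q₃ x ^ 2)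
    (hne : ∀ x ∈ Ω, Qz q₁ q₂ q₃ x ≠ 0) :
    ∃ α β : ℝ, (α ≠ 0 ∨ β ≠ 0) ∧ ∀ x ∈ Ω, β * q₂ x = α * q₃ x := by
  by_cases hall : ∀ x ∈ Ω, q₂ x ^ 2 + q₃ x ^ 2 = 0
  · refine ⟨1, 0, .inl one_ne_zero, fun x hx => ?_⟩
    have : q₃ x = 0 := by nlinarith [hall x hx, sq_nonneg (q₂ x), sq_nonneg (q₃ x)]
    simp [this]
  push Not at hall
  obtain ⟨x₀, hx₀, hr₀⟩ := hall
  have hq1 : ∀ x ∈ Ω, q₁ x ≠ 0 := by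
    intro x hx h0
    have hr : q₂ x ^ 2 + q₃ x ^ 2 = 0 := by
      rcases hcases x hx with h | h
      · exact h
      · rw [← h, h0]; norm_num
    have e2 : q₂ x = 0 := by nlinarith [sq_nonneg (q₂ x), sq_nonneg (q₃ x)]
    have e3 : q₃ x = 0 := by nlinarith [sq_nonneg (q₂ x), sq_nonneg (q₃ x)]
    exact hne x hx (Qz_eq_zero_of q₁ q₂ q₃ x h0 e2 e3)
  have hB : ∀ x ∈ Ω, 3 * q₁ x ^ 2 = q₂ x ^ 2 + q₃ x ^ 2 := by
    intro x hx
    by_contra hxB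
    have hxA := (hcases x hx).resolve_right hxB
    have hcont : ContinuousOn (fun y => q₂ y ^ 2 + q₃ y ^ 2 - q₁ y ^ 2) Ω :=
      ((h2.continuousOn.pow 2).add (h3.continuousOn.pow 2)).sub (h1.continuousOn.pow 2)
    have hx0B := (hcases x₀ hx₀).resolve_left hr₀
    obtain ⟨y, hy, hy0⟩ := hconn.intermediate_value hx hx₀ hcont
      (show (0 : ℝ) ∈ Set.Icc _ _ from
        ⟨by nlinarith [sq_nonneg (q₁ x)], by nlinarith [sq_nonneg (q₁ x₀)]⟩)
    have hpos : 0 < q₁ y ^ 2 := by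
      have := hq1 y hy
      positivity
    simp only at hy0
    rcases hcases y hy with h | h <;> linarith
  have hkey : ∀ x ∈ Ω, ∀ i, HasPd i (fun y => q₂ y / q₁ y) 0 x ∧
      HasPd i (fun y => q₃ y / q₁ y) 0 x := by
    intro x hx i
    obtain ⟨l1, l2, l3⟩ := hEL.scalar_equations hΩ h1 h2 h3 hx
    have hx3 := hB x hx
    have l1' : lap q₁ x = potential t q₁ q₂ q₃ x * q₁ x := by
      rw [l1, potential]
      linear_combination -3 * hx3
    obtain ⟨g, g'⟩ := cross_gradient_eq_zero hΩ h1 h2 h3 hB hx l1' l2 l3 i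
    have h30 : 3 * q₁ x ≠ 0 := mul_ne_zero (by norm_num) (hq1 x hx)
    refine ⟨hasPd_div_eq_zero (h2.hasPd hΩ hx i) (h1.hasPd hΩ hx i) (hq1 x hx) ?_,
      hasPd_div_eq_zero (h3.hasPd hΩ hx i) (h1.hasPd hΩ hx i) (hq1 x hx) ?_⟩
    · refine mul_left_cancel₀ h30 ?_
      linear_combination pd i q₂ x * hx3 - q₂ x * g - q₃ x * g'
    · refine mul_left_cancel₀ h30 ?_
      linear_combination pd i q₃ x * hx3 - q₃ x * g + q₂ x * g'
  obtain ⟨α, hα⟩ := exists_eq_const_of_pd_eq_zero hΩ hconn fun x hx i => (hkey x hx i).1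
  obtain ⟨β, hβ⟩ := exists_eq_const_of_pd_eq_zero hΩ hconn fun x hx i => (hkey x hx i).2
  have e2 : ∀ x ∈ Ω, q₂ x = α * q₁ x := fun x hx => (div_eq_iff (hq1 x hx)).1 (hα x hx)
  have e3 : ∀ x ∈ Ω, q₃ x = β * q₁ x := fun x hx => (div_eq_iff (hq1 x hx)).1 (hβ x hx)
  refine ⟨α, β, ?_, fun x hx => ?_⟩
  · by_contra hcon
    push Not at hcon
    exact hr₀ (by rw [e2 x₀ hx₀, e3 x₀ hx₀, hcon.1, hcon.2]; ring)
  · rw [e2 x hx, e3 x hx]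
    ring

end EulerLagrange

/-- if `Q = q₁E₁ + q₂E₂ + q₃E₃` (so `e_z` is a fixed eigenvector) solves
the one-constant LdG Euler–Lagrange equations on an open set Ω and is uniaxial at every
point, then on every connected component of `{Q ≠ 0}` the eigenframe of `Q` is constant;
if moreover Ω is connected, `Q` has a constant eigenframe on all of Ω. -/
theorem stmt14 (t : ℝ) (Ω : Set (Fin 3 → ℝ)) (hΩ : IsOpen Ω)
    (q₁ q₂ q₃ : (Fin 3 → ℝ) → ℝ)
    (h1 : ContDiffOn ℝ (⊤ : ℕ∞) q₁ Ω)
    (h2 : ContDiffOn ℝ (⊤ : ℕ∞) q₂ Ω)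
    (h3 : ContDiffOn ℝ (⊤ : ℕ∞) q₃ Ω)
    (hEL : LdG_EL t Ω (Qz q₁ q₂ q₃))
    (huni : ∀ x ∈ Ω,
      ((Qz q₁ q₂ q₃ x * Qz q₁ q₂ q₃ x).trace) ^ 3
        = 6 * ((Qz q₁ q₂ q₃ x * Qz q₁ q₂ q₃ x * Qz q₁ q₂ q₃ x).trace) ^ 2) :
    (∀ x₀ ∈ {x ∈ Ω | Qz q₁ q₂ q₃ x ≠ 0},
      ∃ v : Fin 3 → Fin 3 → ℝ,
        (∀ i j : Fin 3, (∑ k : Fin 3, v i k * v j k) = kron i j)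
        ∧ ∀ x ∈ connectedComponentIn {x ∈ Ω | Qz q₁ q₂ q₃ x ≠ 0} x₀,
            ∀ i : Fin 3, ∃ μ : ℝ, (Qz q₁ q₂ q₃ x).mulVec (v i) = μ • v i)
    ∧ (IsConnected Ω →
        ∃ v : Fin 3 → Fin 3 → ℝ,
          (∀ i j : Fin 3, (∑ k : Fin 3, v i k * v j k) = kron i j)
          ∧ ∀ x ∈ Ω, ∀ i : Fin 3, ∃ μ : ℝ, (Qz q₁ q₂ q₃ x).mulVec (v i) = μ • v i) := by
  have hcases := fun x hx => uniaxial_cases (huni x hx)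
  have hcont : ContinuousOn (Qz q₁ q₂ q₃) Ω :=
    ((h1.continuousOn.smul continuousOn_const).add
      (h2.continuousOn.smul continuousOn_const)).add (h3.continuousOn.smul continuousOn_const)
  set W := {x ∈ Ω | Qz q₁ q₂ q₃ x ≠ 0} with hW
  have hWo : IsOpen W := hcont.isOpen_inter_preimage hΩ isOpen_compl_singleton
  have hdir : ∀ x₀ ∈ W, ∃ α β : ℝ, (α ≠ 0 ∨ β ≠ 0) ∧
      ∀ x ∈ connectedComponentIn W x₀, β * q₂ x = α * q₃ x := by
    intro x₀ _
    have hsub : connectedComponentIn W x₀ ⊆ W := connectedComponentIn_subset W x₀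
    have hsubΩ : connectedComponentIn W x₀ ⊆ Ω := fun x hx => (hsub hx).1
    exact exists_direction (t := t) hWo.connectedComponentIn isPreconnected_connectedComponentIn
      (h1.mono hsubΩ) (h2.mono hsubΩ) (h3.mono hsubΩ) (fun x hx => hEL x (hsubΩ hx))
      (fun x hx => hcases x (hsubΩ hx)) fun x hx => (hsub hx).2
  refine ⟨fun x₀ hx₀ => ?_, fun hconn => ?_⟩
  · obtain ⟨α, β, hne, h⟩ := hdir x₀ hx₀
    obtain ⟨v, hv, hframe⟩ := exists_common_frame hne
    exact ⟨v, hv, fun x hx => hframe _ _ _ (h x hx)⟩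
  by_cases hWe : W.Nonempty
  · obtain ⟨x₀, hx₀⟩ := hWe
    obtain ⟨α, β, hne, h⟩ := hdir x₀ hx₀
    obtain ⟨v, hv, hframe⟩ := exists_common_frame hne
    have hpot : ContinuousOn (potential t q₁ q₂ q₃) Ω := by
      have c1 := h1.continuousOn
      have c2 := h2.continuousOn
      have c3 := h3.continuousOn
      unfold potential
      fun_prop
    have hzero := eq_zero_of_lap_eq_mul hΩ hconn.isPreconnected
      (u := fun y => β * q₂ y + (-α) * q₃ y) (c := potential t q₁ q₂ q₃)
      ((contDiffOn_const.mul h2).add (contDiffOn_const.mul h3)) hpot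
      (fun x hx => by
        obtain ⟨_, l2, l3⟩ := hEL.scalar_equations hΩ h1 h2 h3 hx
        rw [lap_linear_combination hΩ h2 h3 hx, l2, l3]
        ring)
      (hWo.connectedComponentIn (x := x₀)) ⟨x₀, hx₀.1, mem_connectedComponentIn hx₀⟩
      (fun x hx => by linarith [h x hx.2])
    exact ⟨v, hv, fun x hx => hframe _ _ _ (by linarith [hzero x hx])⟩
  · obtain ⟨v, hv, -⟩ := exists_common_frame (α := 1) (β := 0) (.inl one_ne_zero)
    refine ⟨v, hv, fun x hx i => ⟨0, ?_⟩⟩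
    have hQ : Qz q₁ q₂ q₃ x = 0 := by
      by_contra hQ
      exact hWe ⟨x, hx, hQ⟩
    simp [hQ]

end
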